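/- arXiv:2112.13982 — 7 statements merged into one kernel-verified Lean document; each statement's English description precedes it below -/
import Mathlib

section
/- Every n×n quaternion matrix M with n ≥ 1 has a standard eigenvalue: there exists a complex number λ with nonnegative imaginary part such that the quaternion λ.re + λ.im · i is a right eigenvalue of M, i.e., there exists a nonzero vector x ∈ ℍⁿ with (M x)ᵢ = xᵢ (λ.re + λ.im · i) for all i. -/
/-- A complex number `a + b i` regarded as the quaternion `a + b i + 0 j + 0 k`. -/
def toQuat (z : ℂ) : Quaternion ℝ := ⟨z.re, z.im, 0, 0⟩

/-- The embedding of `ℂ` in the opposite of the quaternions, through which `ℂ` acts on quaternion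
vectors by right multiplication. -/
noncomputable def complexToQuaternionOp : ℂ →+* (Quaternion ℝ)ᵐᵒᵖ :=
  (Quaternion.ofComplex : ℂ →+* Quaternion ℝ).toOpposite fun x y => by
    change _ * _ = _ * _
    rw [← map_mul, ← map_mul, mul_comm]

/-- Every nonempty square quaternion matrix has a complex right eigenvalue. -/
theorem exists_complex_right_eigenvalue {ι : Type*} [Fintype ι] [Nonempty ι]
    (M : Matrix ι ι (Quaternion ℝ)) :
    ∃ lam : ℂ, ∃ x : ι → Quaternion ℝ, x ≠ 0 ∧ ∀ i, M.mulVec x i = x i * toQuat lam := by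
  let : Module ℂ (ι → Quaternion ℝ) := Module.compHom _ complexToQuaternionOp
  have smul_apply (z : ℂ) (x : ι → Quaternion ℝ) (i : ι) : (z • x) i = x i * toQuat z := rfl
  have : IsScalarTower ℝ ℂ (ι → Quaternion ℝ) := ⟨fun r z x => by
    have h : toQuat (r • z) = r • toQuat z := map_smul Quaternion.ofComplex r z
    ext1 i
    rw [smul_apply, h, mul_smul_comm, Pi.smul_apply, smul_apply]⟩
  have : Module.Finite ℂ (ι → Quaternion ℝ) := Module.Finite.of_restrictScalars_finite ℝ ℂ _
  let f : Module.End ℂ (ι → Quaternion ℝ) :=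
    { toFun := M.mulVec
      map_add' := M.mulVec_add
      map_smul' := fun z x => by
        ext1 i
        simp only [RingHom.id_apply, smul_apply, Matrix.mulVec, dotProduct, Finset.sum_mul,
          mul_assoc] }
  obtain ⟨lam, h⟩ := Module.End.exists_eigenvalue f
  obtain ⟨x, hx⟩ := h.exists_hasEigenvector
  exact ⟨lam, x, hx.2, fun i => congrFun hx.apply_eq_smul i⟩

/-- every `n × n` quaternion matrix with `n ≥ 1` has a standard eigenvalue:
a complex number `λ` with nonnegative imaginary part which is a right eigenvalue of `M`. -/
theorem exists_standard_eigenvalue {n : ℕ} (hn : 1 ≤ n)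
    (M : Matrix (Fin n) (Fin n) (Quaternion ℝ)) :
    ∃ lam : ℂ, 0 ≤ lam.im ∧ ∃ x : Fin n → Quaternion ℝ, x ≠ 0 ∧
      ∀ i, M.mulVec x i = x i * toQuat lam := by
  have : Nonempty (Fin n) := ⟨⟨0, hn⟩⟩
  obtain ⟨lam, x, hx, h⟩ := exists_complex_right_eigenvalue M
  rcases le_total 0 lam.im with hl | hl
  · exact ⟨lam, hl, x, hx, h⟩
  · let j : Quaternion ℝ := ⟨0, 0, 1, 0⟩
    have hj : j ≠ 0 := fun h => one_ne_zero (congrArg QuaternionAlgebra.imJ h : (1 : ℝ) = 0)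
    have hcomm : toQuat lam * j = j * toQuat (star lam) := by
      ext <;> simp only [Quaternion.re_mul, Quaternion.imI_mul, Quaternion.imJ_mul,
        Quaternion.imK_mul] <;> simp [toQuat, j]
    refine ⟨star lam, by simpa using hl, fun i => x i * j, fun h0 => hx ?_, fun i => ?_⟩
    · ext1 i
      exact (mul_eq_zero.mp (congrFun h0 i)).resolve_right hj
    · calc M.mulVec (fun k => x k * j) i = M.mulVec x i * j := by
            simp only [Matrix.mulVec, dotProduct, Finset.sum_mul, mul_assoc]
        _ = x i * j * toQuat (star lam) := by rw [h, mul_assoc, hcomm, mul_assoc]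
end

section
/- Let Q be an n×n quaternion matrix with complex representation χ_Q, and let λ be a complex number that, regarded as a quaternion, is a right eigenvalue of Q (i.e., there is a nonzero x ∈ ℍⁿ with (Q x)ᵢ = xᵢ λ for all i). Then λ is an eigenvalue of the 2n×2n complex matrix χ_Q, i.e., there is a nonzero vector u ∈ ℂ^{2n} with χ_Q u = λ u. (Concretely, writing each xᵢ = (x₁)ᵢ + (x₂)ᵢ j with complex (x₁)ᵢ, (x₂)ᵢ, the vector u = (x₁; −conj(x₂)) is such an eigenvector.) -/
/-- The complex matrix `Q_a` in the decomposition `Q = Q_a + Q_b j` of a quaternion matrix. -/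
def Qa {m n : ℕ} (Q : Matrix (Fin m) (Fin n) (Quaternion ℝ)) : Matrix (Fin m) (Fin n) ℂ :=
  fun i j => ⟨(Q i j).re, (Q i j).imI⟩

/-- The complex matrix `Q_b` in the decomposition `Q = Q_a + Q_b j` of a quaternion matrix. -/
def Qb {m n : ℕ} (Q : Matrix (Fin m) (Fin n) (Quaternion ℝ)) : Matrix (Fin m) (Fin n) ℂ :=
  fun i j => ⟨(Q i j).imJ, (Q i j).imK⟩

/-- The complex representation `χ_Q = [[Q_a, Q_b], [-conj Q_b, conj Q_a]]` of a
quaternion matrix `Q`. -/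
def chi {m n : ℕ} (Q : Matrix (Fin m) (Fin n) (Quaternion ℝ)) :
    Matrix (Fin m ⊕ Fin m) (Fin n ⊕ Fin n) ℂ :=
  Matrix.fromBlocks (Qa Q) (Qb Q) (-((Qb Q).map (starRingEnd ℂ))) ((Qa Q).map (starRingEnd ℂ))

/-- The additive map sending `a + b j` to the complex number `a`. -/
def quatFst : Quaternion ℝ →+ ℂ where
  toFun q := ⟨q.re, q.imI⟩
  map_zero' := rfl
  map_add' p q := by apply Complex.ext <;> simp

/-- The additive map sending `a + b j` to the complex number `-conj b`. -/
def quatNegConjSnd : Quaternion ℝ →+ ℂ where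
  toFun q := ⟨-q.imJ, q.imK⟩
  map_zero' := Complex.ext neg_zero rfl
  map_add' p q := by apply Complex.ext <;> simp [add_comm]

@[simp] theorem quatFst_re (q : Quaternion ℝ) : (quatFst q).re = q.re := rfl

@[simp] theorem quatFst_im (q : Quaternion ℝ) : (quatFst q).im = q.imI := rfl

@[simp] theorem quatNegConjSnd_re (q : Quaternion ℝ) : (quatNegConjSnd q).re = -q.imJ := rfl

@[simp] theorem quatNegConjSnd_im (q : Quaternion ℝ) : (quatNegConjSnd q).im = q.imK := rfl

@[simp] theorem toQuat_re (z : ℂ) : (toQuat z).re = z.re := rfl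

@[simp] theorem toQuat_imI (z : ℂ) : (toQuat z).imI = z.im := rfl

@[simp] theorem toQuat_imJ (z : ℂ) : (toQuat z).imJ = 0 := rfl

@[simp] theorem toQuat_imK (z : ℂ) : (toQuat z).imK = 0 := rfl

theorem quatFst_mul_toQuat (q : Quaternion ℝ) (z : ℂ) :
    quatFst (q * toQuat z) = z * quatFst q := by
  apply Complex.ext <;> simp <;> ring

theorem quatNegConjSnd_mul_toQuat (q : Quaternion ℝ) (z : ℂ) :
    quatNegConjSnd (q * toQuat z) = z * quatNegConjSnd q := by
  apply Complex.ext <;> simp <;> ring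

theorem quatFst_mulVec {m n : ℕ} (Q : Matrix (Fin m) (Fin n) (Quaternion ℝ))
    (x : Fin n → Quaternion ℝ) (i : Fin m) :
    quatFst (Q.mulVec x i) =
      (chi Q).mulVec (Sum.elim (quatFst ∘ x) (quatNegConjSnd ∘ x)) (Sum.inl i) := by
  simp only [Matrix.mulVec, dotProduct, map_sum, Fintype.sum_sum_type, chi,
    Matrix.fromBlocks_apply₁₁, Matrix.fromBlocks_apply₁₂, Sum.elim_inl, Sum.elim_inr,
    Function.comp_apply, ← Finset.sum_add_distrib]
  refine Finset.sum_congr rfl fun j _ => ?_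
  apply Complex.ext <;> simp [Qa, Qb] <;> ring

theorem quatNegConjSnd_mulVec {m n : ℕ} (Q : Matrix (Fin m) (Fin n) (Quaternion ℝ))
    (x : Fin n → Quaternion ℝ) (i : Fin m) :
    quatNegConjSnd (Q.mulVec x i) =
      (chi Q).mulVec (Sum.elim (quatFst ∘ x) (quatNegConjSnd ∘ x)) (Sum.inr i) := by
  simp only [Matrix.mulVec, dotProduct, map_sum, Fintype.sum_sum_type, chi,
    Matrix.fromBlocks_apply₂₁, Matrix.fromBlocks_apply₂₂, Sum.elim_inl, Sum.elim_inr,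
    Function.comp_apply, ← Finset.sum_add_distrib]
  refine Finset.sum_congr rfl fun j _ => ?_
  apply Complex.ext <;> simp [Qa, Qb] <;> ring

/-- if the complex number `λ`, regarded as a quaternion, is a right eigenvalue
of the `n × n` quaternion matrix `Q`, then `λ` is an eigenvalue of the complex
representation `χ_Q`. -/
theorem eigenvalue_chi_of_right_eigenvalue {n : ℕ} (Q : Matrix (Fin n) (Fin n) (Quaternion ℝ))
    (lam : ℂ) (x : Fin n → Quaternion ℝ) (hx : x ≠ 0)
    (heig : ∀ i, Q.mulVec x i = x i * toQuat lam) :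
    ∃ u : Fin n ⊕ Fin n → ℂ, u ≠ 0 ∧ (chi Q).mulVec u = lam • u := by
  refine ⟨Sum.elim (quatFst ∘ x) (quatNegConjSnd ∘ x), fun h => hx ?_, ?_⟩
  · funext i
    have h₁ : quatFst (x i) = 0 := congrFun h (Sum.inl i)
    have h₂ : quatNegConjSnd (x i) = 0 := congrFun h (Sum.inr i)
    simp only [Complex.ext_iff, quatFst_re, quatFst_im, quatNegConjSnd_re, quatNegConjSnd_im,
      Complex.zero_re, Complex.zero_im, neg_eq_zero] at h₁ h₂
    exact Quaternion.ext _ _ h₁.1 h₁.2 h₂.1 h₂.2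
  · funext i
    cases i with
    | inl i => rw [← quatFst_mulVec, heig, quatFst_mul_toQuat]; rfl
    | inr i => rw [← quatNegConjSnd_mulVec, heig, quatNegConjSnd_mul_toQuat]; rfl
end

section
/- Let Q be an n×n quaternion matrix with complex representation χ_Q. If λ ∈ ℂ is an eigenvalue of χ_Q (i.e., there is a nonzero u ∈ ℂ^{2n} with χ_Q u = λ u), then the complex conjugate conj(λ) is also an eigenvalue of χ_Q. Hence the eigenvalues of χ_Q occur in conjugate pairs. -/
/-- The conjugate-linear structure map `(x, y) ↦ (-conj y, conj x)` on `ℂ^{2n}`, which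
corresponds to multiplication by `j`. -/
def conjSwap {n : ℕ} (u : Fin n ⊕ Fin n → ℂ) : Fin n ⊕ Fin n → ℂ :=
  Sum.elim (fun i => -(starRingEnd ℂ (u (Sum.inr i)))) (fun i => starRingEnd ℂ (u (Sum.inl i)))

/-- The structure map commutes with the complex representation of a quaternion matrix. -/
theorem chi_mulVec_conjSwap {m n : ℕ} (Q : Matrix (Fin m) (Fin n) (Quaternion ℝ))
    (u : Fin n ⊕ Fin n → ℂ) :
    (chi Q).mulVec (conjSwap u) = conjSwap ((chi Q).mulVec u) := by
  ext (i | i)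
  · simp [chi, conjSwap, Matrix.mulVec, dotProduct]
  · simp [chi, conjSwap, Matrix.mulVec, dotProduct, add_comm]

theorem conjSwap_smul {n : ℕ} (c : ℂ) (u : Fin n ⊕ Fin n → ℂ) :
    conjSwap (c • u) = starRingEnd ℂ c • conjSwap u := by
  ext (i | i) <;> simp [conjSwap]

theorem conjSwap_ne_zero {n : ℕ} {u : Fin n ⊕ Fin n → ℂ} (hu : u ≠ 0) : conjSwap u ≠ 0 := by
  contrapose! hu
  ext1 (i | i)
  · simpa [conjSwap] using congrFun hu (Sum.inr i)
  · simpa [conjSwap] using congrFun hu (Sum.inl i)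

/-- the eigenvalues of the complex representation `χ_Q` of a quaternion matrix
occur in conjugate pairs: if `λ` is an eigenvalue of `χ_Q` then so is `conj λ`. -/
theorem chi_eigenvalue_conj {n : ℕ} (Q : Matrix (Fin n) (Fin n) (Quaternion ℝ))
    (lam : ℂ) (u : Fin n ⊕ Fin n → ℂ) (hu : u ≠ 0)
    (heig : (chi Q).mulVec u = lam • u) :
    ∃ v : Fin n ⊕ Fin n → ℂ, v ≠ 0 ∧ (chi Q).mulVec v = (starRingEnd ℂ lam) • v := by
  exact ⟨conjSwap u, conjSwap_ne_zero hu, by rw [chi_mulVec_conjSwap, heig, conjSwap_smul]⟩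
end

section
/- Singular value decomposition of a quaternion matrix (QSVD): for every quaternion matrix Q ∈ ℍ^{m×n} there exist a unitary quaternion matrix U ∈ ℍ^{m×m} (Uᴴ U = I), a unitary quaternion matrix V ∈ ℍ^{n×n} (Vᴴ V = I), and a matrix S ∈ ℍ^{m×n} whose entries satisfy S_{ij} = 0 whenever i ≠ j and whose diagonal entries S_{ii} are nonnegative real scalars (quaternions with zero imaginary part), such that Q = U S Vᴴ. -/
open Matrix

open scoped Quaternion

namespace QuaternionMatrix

variable {ι κ : Type*} [Fintype ι] [Fintype κ]

/-- Real parts of quaternions commute under multiplication. -/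
theorem re_mul_comm (a b : Quaternion ℝ) : (a * b).re = (b * a).re := by
  simp only [Quaternion.re_mul]
  ring

theorem re_sum {α : Type*} (s : Finset α) (f : α → Quaternion ℝ) :
    (∑ i ∈ s, f i).re = ∑ i ∈ s, (f i).re := by
  classical
  induction s using Finset.induction_on with
  | empty => simp
  | insert a s ha ih => simp [Finset.sum_insert ha, ih]

instance : StarModule ℝ (Quaternion ℝ) :=
  ⟨fun r q => by rw [Quaternion.star_smul, star_trivial r]⟩

/-- The real part of the trace is cyclic, even though the quaternions do not commute. -/
theorem re_trace_mul_comm (A : Matrix ι κ (Quaternion ℝ)) (B : Matrix κ ι (Quaternion ℝ)) :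
    (A * B).trace.re = (B * A).trace.re := by
  simp only [Matrix.trace, Matrix.diag, Matrix.mul_apply, re_sum]
  rw [Finset.sum_comm]
  simp only [re_mul_comm]

/-- The generalized reflection `1 + W ((P - 1) / N) Wᴴ` is an isometry if `Wᴴ W = N` and
`P` is an isometry. -/
theorem conjTranspose_mul_self_reflection [DecidableEq ι] [DecidableEq κ]
    (W : Matrix ι κ (Quaternion ℝ)) (P : Matrix κ κ (Quaternion ℝ)) {N : ℝ} (hN : N ≠ 0)
    (hW : Wᴴ * W = N • (1 : Matrix κ κ (Quaternion ℝ))) (hP : Pᴴ * P = 1) :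
    (1 + W * (N⁻¹ • (P - 1)) * Wᴴ)ᴴ * (1 + W * (N⁻¹ • (P - 1)) * Wᴴ) = 1 := by
  set R := N⁻¹ • (P - 1) with hR
  have hRR : R + Rᴴ + Rᴴ * (N • 1) * R = 0 := by
    have h : (Pᴴ - 1) * (P - 1) = 2 - P - Pᴴ := by
      rw [sub_mul, mul_sub, hP, mul_one, one_mul, ← one_add_one_eq_two]
      abel
    simp only [hR, conjTranspose_smul, conjTranspose_sub, conjTranspose_one, star_trivial,
      smul_mul_assoc, mul_smul_comm, smul_smul, mul_one, h, mul_inv_cancel₀ hN]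
    rw [← smul_add, ← smul_add, ← one_add_one_eq_two]
    convert smul_zero _
    abel
  have hexp : (1 + W * R * Wᴴ)ᴴ * (1 + W * R * Wᴴ)
      = 1 + W * (R + Rᴴ + Rᴴ * (Wᴴ * W) * R) * Wᴴ := by
    simp only [conjTranspose_add, conjTranspose_one, conjTranspose_mul,
      conjTranspose_conjTranspose, Matrix.add_mul, Matrix.mul_add, Matrix.one_mul,
      Matrix.mul_one, Matrix.mul_assoc]
    abel
  rw [hexp, hW, hRR]
  simp

theorem reflection_mem_unitary [DecidableEq ι] [DecidableEq κ]
    (W : Matrix ι κ (Quaternion ℝ)) (P : Matrix κ κ (Quaternion ℝ)) {N : ℝ} (hN : N ≠ 0)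
    (hW : Wᴴ * W = N • (1 : Matrix κ κ (Quaternion ℝ))) (hP : P ∈ unitary (Matrix κ κ _)) :
    1 + W * (N⁻¹ • (P - 1)) * Wᴴ ∈ unitary (Matrix ι ι (Quaternion ℝ)) := by
  rw [Unitary.mem_iff] at hP ⊢
  refine ⟨conjTranspose_mul_self_reflection W P hN hW hP.1, ?_⟩
  have h := conjTranspose_mul_self_reflection W Pᴴ hN hW
    (by rw [conjTranspose_conjTranspose]; exact hP.2)
  have e : (1 + W * (N⁻¹ • (P - 1)) * Wᴴ)ᴴ = 1 + W * (N⁻¹ • (Pᴴ - 1)) * Wᴴ := by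
    simp [conjTranspose_mul, conjTranspose_smul, Matrix.mul_assoc]
  rw [star_eq_conjTranspose, e]
  rwa [← e, conjTranspose_conjTranspose, e] at h

theorem eq_coe_norm_of_norm_le_re {z : Quaternion ℝ} (h : ‖z‖ ≤ z.re) : z = (‖z‖ : ℝ) := by
  have h1 : z.re ^ 2 + z.imI ^ 2 + z.imJ ^ 2 + z.imK ^ 2 = ‖z‖ * ‖z‖ := by
    rw [← Quaternion.normSq_eq_norm_mul_self, Quaternion.normSq_def']
  have h0 := norm_nonneg z
  have hI : z.imI ^ 2 ≤ 0 := by nlinarith [sq_nonneg z.imJ, sq_nonneg z.imK]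
  have hJ : z.imJ ^ 2 ≤ 0 := by nlinarith [sq_nonneg z.imI, sq_nonneg z.imK]
  have hK : z.imK ^ 2 ≤ 0 := by nlinarith [sq_nonneg z.imJ, sq_nonneg z.imI]
  have hI' : z.imI = 0 := by nlinarith
  have hJ' : z.imJ = 0 := by nlinarith
  have hK' : z.imK = 0 := by nlinarith
  have hre : z.re = ‖z‖ := by
    rw [hI', hJ', hK'] at h1
    nlinarith
  ext <;> simp [hI', hJ', hK', hre]

theorem norm_le_re_of_forall_unit {z : Quaternion ℝ}
    (h : ∀ u : Quaternion ℝ, star u * u = 1 → u * star u = 1 → (u * z).re ≤ z.re) :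
    ‖z‖ ≤ z.re := by
  rcases eq_or_ne z 0 with rfl | hz
  · simp
  have hn : ‖z‖ ≠ 0 := norm_ne_zero_iff.2 hz
  have h1 : star z * z = ((‖z‖ * ‖z‖ : ℝ) : Quaternion ℝ) := by
    rw [Quaternion.star_mul_self, Quaternion.normSq_eq_norm_mul_self]
  have h2 : z * star z = ((‖z‖ * ‖z‖ : ℝ) : Quaternion ℝ) := by
    rw [Quaternion.self_mul_star, Quaternion.normSq_eq_norm_mul_self]
  have key := h (‖z‖⁻¹ • star z)
    (by
      rw [star_smul, star_star, smul_mul_smul_comm, h2, ← Quaternion.coe_smul, smul_eq_mul,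
        star_trivial ‖z‖⁻¹, ← mul_inv, inv_mul_cancel₀ (mul_ne_zero hn hn), Quaternion.coe_one])
    (by
      rw [star_smul, star_star, smul_mul_smul_comm, h1, ← Quaternion.coe_smul, smul_eq_mul,
        star_trivial ‖z‖⁻¹, ← mul_inv, inv_mul_cancel₀ (mul_ne_zero hn hn), Quaternion.coe_one])
  rw [smul_mul_assoc, h1, ← Quaternion.coe_smul, Quaternion.re_coe, smul_eq_mul,
    inv_mul_cancel_left₀ hn] at key
  exact key

/-- If the identity maximizes `H ↦ re (tr (M H))` among unitary matrices, then the quadratic form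
of `M` takes nonnegative real values. -/
theorem quadraticForm_eq_coe_norm [DecidableEq ι] {M : Matrix ι ι (Quaternion ℝ)}
    (hM : ∀ H ∈ unitary (Matrix ι ι (Quaternion ℝ)), (M * H).trace.re ≤ M.trace.re)
    (w : ι → Quaternion ℝ) :
    star w ⬝ᵥ (M *ᵥ w) = (‖star w ⬝ᵥ (M *ᵥ w)‖ : ℝ) := by
  rcases eq_or_ne w 0 with rfl | hw
  · simp
  apply eq_coe_norm_of_norm_le_re
  apply norm_le_re_of_forall_unit
  intro u hu hu'
  let W : Matrix ι (Fin 1) (Quaternion ℝ) := Matrix.of fun i _ => w i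
  let P : Matrix (Fin 1) (Fin 1) (Quaternion ℝ) := Matrix.of fun _ _ => u
  let N : ℝ := ∑ i, Quaternion.normSq (w i)
  have hN : 0 < N := by
    obtain ⟨i, hi⟩ := Function.ne_iff.1 hw
    exact Finset.sum_pos' (fun i _ => Quaternion.normSq_nonneg)
      ⟨i, Finset.mem_univ i, lt_of_le_of_ne Quaternion.normSq_nonneg
        (Ne.symm (Quaternion.normSq_ne_zero.2 hi))⟩
  have hW : Wᴴ * W = N • (1 : Matrix (Fin 1) (Fin 1) (Quaternion ℝ)) := by
    ext1 a b
    fin_cases a; fin_cases b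
    have : ((N : ℝ) : Quaternion ℝ) = ∑ i, star (w i) * w i := by
      simp only [Quaternion.star_mul_self]
      exact map_sum (algebraMap ℝ (Quaternion ℝ)) _ _
    simp only [Matrix.mul_apply, W, conjTranspose_apply, of_apply, ← this]
    simp [Algebra.smul_def]
  have hP : P ∈ unitary (Matrix (Fin 1) (Fin 1) (Quaternion ℝ)) := by
    rw [Unitary.mem_iff]
    constructor <;> ext1 a b <;> fin_cases a <;> fin_cases b <;>
      simp [P, Matrix.mul_apply, star_eq_conjTranspose, hu, hu']
  have h := hM _ (reflection_mem_unitary W P hN.ne' hW hP)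
  have hz : Wᴴ * (M * W) = Matrix.of fun _ _ => star w ⬝ᵥ (M *ᵥ w) := by
    ext1 a b
    simp [Matrix.mul_apply, W, dotProduct, mulVec]
  have ht : (M * (W * (N⁻¹ • (P - 1)) * Wᴴ)).trace.re
      = N⁻¹ * ((u - 1) * (star w ⬝ᵥ (M *ᵥ w))).re := by
    have e : M * (W * (N⁻¹ • (P - 1)) * Wᴴ) = (M * W) * ((N⁻¹ • (P - 1)) * Wᴴ) := by
      simp only [Matrix.mul_assoc]
    rw [e, re_trace_mul_comm, Matrix.mul_assoc, hz]
    simp [P, Matrix.trace, Matrix.mul_apply, -Quaternion.re_mul]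
  rw [Matrix.mul_add, Matrix.mul_one, trace_add, Quaternion.re_add, ht, sub_mul, one_mul,
    Quaternion.re_sub] at h
  have := nonpos_of_mul_nonpos_right (le_of_add_le_add_left (h.trans_eq (add_zero _).symm))
    (inv_pos.2 hN)
  linarith

/-- A quaternion matrix whose quadratic form is real-valued is Hermitian. -/
theorem isHermitian_of_quadraticForm [DecidableEq ι] {M : Matrix ι ι (Quaternion ℝ)}
    (hM : ∀ w : ι → Quaternion ℝ, star (star w ⬝ᵥ (M *ᵥ w)) = star w ⬝ᵥ (M *ᵥ w)) :
    M.IsHermitian := by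
  have key (i j : ι) (q : Quaternion ℝ) :
      star (M i j * q + star q * M j i) = M i j * q + star q * M j i := by
    have e : star (Pi.single i 1 + Pi.single j q : ι → Quaternion ℝ) ⬝ᵥ
          (M *ᵥ (Pi.single i 1 + Pi.single j q))
        = star (Pi.single i 1 : ι → Quaternion ℝ) ⬝ᵥ (M *ᵥ Pi.single i 1)
          + star (Pi.single j q : ι → Quaternion ℝ) ⬝ᵥ (M *ᵥ Pi.single j q)
          + (M i j * q + star q * M j i) := by
      simp only [star_add, mulVec_add, add_dotProduct, dotProduct_add, ← Pi.single_star,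
        single_dotProduct, mulVec_single, star_one]
      simp
      abel
    have h := hM (Pi.single i 1 + Pi.single j q)
    rw [e, star_add, star_add, hM, hM] at h
    exact add_left_cancel h
  ext1 i j
  rw [conjTranspose_apply]
  have h1 := key i j 1
  obtain ⟨q, q0, q1, q2, q3⟩ :
      ∃ q : Quaternion ℝ, q.re = 0 ∧ q.imI = 1 ∧ q.imJ = 0 ∧ q.imK = 0 :=
    ⟨⟨0, 1, 0, 0⟩, rfl, rfl, rfl, rfl⟩
  have h2 := key i j q
  simp only [Quaternion.ext_iff, Quaternion.re_add, Quaternion.imI_add, Quaternion.imJ_add,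
    Quaternion.imK_add, Quaternion.re_mul, Quaternion.imI_mul, Quaternion.imJ_mul,
    Quaternion.imK_mul, Quaternion.re_star, Quaternion.imI_star, Quaternion.imJ_star,
    Quaternion.imK_star, Quaternion.re_one, Quaternion.imI_one, Quaternion.imJ_one,
    Quaternion.imK_one, q0, q1, q2, q3] at h1 h2
  obtain ⟨-, h1I, h1J, h1K⟩ := h1
  obtain ⟨-, h2I, -, -⟩ := h2
  ext <;> simp only [Quaternion.re_star, Quaternion.imI_star, Quaternion.imJ_star,
    Quaternion.imK_star] <;> linarith

/-- The unitary group of quaternion matrices is compact. -/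
theorem isCompact_unitary [DecidableEq ι] :
    IsCompact (unitary (Matrix ι ι (Quaternion ℝ)) : Set (Matrix ι ι (Quaternion ℝ))) := by
  have : ProperSpace (Quaternion ℝ) := FiniteDimensional.proper_real _
  have hK : IsCompact (Set.univ.pi fun _ : ι => Set.univ.pi fun _ : ι =>
      Metric.closedBall (0 : Quaternion ℝ) 1) :=
    isCompact_univ_pi fun _ => isCompact_univ_pi fun _ => isCompact_closedBall _ _
  refine hK.of_isClosed_subset ?_ ?_
  · have : (unitary (Matrix ι ι (Quaternion ℝ)) : Set (Matrix ι ι (Quaternion ℝ)))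
        = {U | Uᴴ * U = 1} ∩ {U | U * Uᴴ = 1} := by
      ext U
      exact Unitary.mem_iff
    rw [this]
    exact (isClosed_eq (by fun_prop) continuous_const).inter
      (isClosed_eq (by fun_prop) continuous_const)
  · rintro (U : Matrix ι ι (Quaternion ℝ)) (hU : U ∈ unitary (Matrix ι ι (Quaternion ℝ))) i _ j _
    have hU' : Uᴴ * U = 1 := (Unitary.mem_iff.1 hU).1
    have h : (Uᴴ * U) j j = 1 := by
      rw [hU', one_apply_eq]
    have h' : ∑ k, Quaternion.normSq (U k j) = 1 := by
      have := congrArg (fun q : Quaternion ℝ => q.re) h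
      simpa only [Matrix.mul_apply, conjTranspose_apply, Quaternion.star_mul_self, re_sum,
        Quaternion.re_coe, Quaternion.re_one] using this
    have h'' : Quaternion.normSq (U i j) ≤ 1 := h' ▸ Finset.single_le_sum
      (f := fun k => Quaternion.normSq (U k j))
      (fun k _ => Quaternion.normSq_nonneg) (Finset.mem_univ i)
    rw [Quaternion.normSq_eq_norm_mul_self] at h''
    rw [mem_closedBall_zero_iff]
    nlinarith [norm_nonneg (U i j)]

/-- If the identity maximizes `H ↦ re (tr (M H))` among unitary matrices, then `M` is Hermitian
with nonnegative diagonal. -/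
theorem isHermitian_and_diag_nonneg [DecidableEq ι] {M : Matrix ι ι (Quaternion ℝ)}
    (hM : ∀ H ∈ unitary (Matrix ι ι (Quaternion ℝ)), (M * H).trace.re ≤ M.trace.re) :
    M.IsHermitian ∧ ∀ i, 0 ≤ (M i i).re := by
  have h := quadraticForm_eq_coe_norm hM
  refine ⟨isHermitian_of_quadraticForm fun w => ?_, fun i => ?_⟩
  · rw [h w, Quaternion.star_coe]
  · have hi := h (Pi.single i 1)
    simp only [← Pi.single_star, single_dotProduct, star_one] at hi
    simp at hi
    rw [hi]
    simp

/-- The `n × m` matrix with diagonal entries `1, 2, 3, …`. -/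
noncomputable def weight (n m : ℕ) : Matrix (Fin n) (Fin m) (Quaternion ℝ) :=
  Matrix.of fun j i => if (j : ℕ) = i then (((j : ℝ) + 1 : ℝ) : Quaternion ℝ) else 0

theorem mul_weight_apply {m n : ℕ} (A : Matrix (Fin m) (Fin n) (Quaternion ℝ))
    (i : Fin m) (j : Fin n) (j' : Fin m) (h : (j : ℕ) = j') :
    (A * weight n m) i j' = ((j : ℝ) + 1) • A i j := by
  rw [Matrix.mul_apply, Finset.sum_eq_single j]
  · simp only [weight, of_apply, if_pos h, Quaternion.mul_coe_eq_smul]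
  · intro k _ hk
    have : (k : ℕ) ≠ j' := fun e => hk (Fin.ext (e.trans h.symm))
    simp [weight, this]
  · simp

theorem mul_weight_apply_of_le {m n : ℕ} (A : Matrix (Fin m) (Fin n) (Quaternion ℝ))
    (i j' : Fin m) (h : n ≤ j') : (A * weight n m) i j' = 0 := by
  rw [Matrix.mul_apply]
  refine Finset.sum_eq_zero fun k _ => ?_
  have : (k : ℕ) ≠ j' := by omega
  simp [weight, this]

theorem weight_mul_apply {m n : ℕ} (A : Matrix (Fin m) (Fin n) (Quaternion ℝ))
    (i' : Fin n) (i : Fin m) (j : Fin n) (h : (i' : ℕ) = i) :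
    (weight n m * A) i' j = ((i : ℝ) + 1) • A i j := by
  rw [Matrix.mul_apply, Finset.sum_eq_single i]
  · simp only [weight, of_apply, h, if_true, Quaternion.coe_mul_eq_smul]
  · intro k _ hk
    have : (i' : ℕ) ≠ k := fun e => hk (Fin.ext (e.symm.trans h))
    simp [weight, this]
  · simp

theorem weight_mul_apply_of_le {m n : ℕ} (A : Matrix (Fin m) (Fin n) (Quaternion ℝ))
    (i' j : Fin n) (h : m ≤ i') : (weight n m * A) i' j = 0 := by
  rw [Matrix.mul_apply]
  refine Finset.sum_eq_zero fun k _ => ?_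
  have : (i' : ℕ) ≠ k := by omega
  simp [weight, this]

theorem eq_zero_of_isHermitian_weight {m n : ℕ} {A : Matrix (Fin m) (Fin n) (Quaternion ℝ)}
    (h₁ : (A * weight n m).IsHermitian) (h₂ : (weight n m * A).IsHermitian)
    (i : Fin m) (j : Fin n) (hij : (i : ℕ) ≠ j) : A i j = 0 := by
  have hpos (k : ℕ) : (k : ℝ) + 1 ≠ 0 := by positivity
  by_cases hi : (i : ℕ) < n
  · have r := h₂.apply ⟨i, hi⟩ j
    rw [weight_mul_apply A ⟨i, hi⟩ i j rfl] at r
    by_cases hj : (j : ℕ) < m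
    · have l := h₁.apply i ⟨j, hj⟩
      rw [mul_weight_apply A i j ⟨j, hj⟩ rfl, mul_weight_apply A ⟨j, hj⟩ ⟨i, hi⟩ i rfl] at l
      rw [weight_mul_apply A j ⟨j, hj⟩ ⟨i, hi⟩ rfl] at r
      rw [star_smul, star_trivial] at l r
      have e : ((j : ℝ) + 1) • ((j : ℝ) + 1) • A i j = ((i : ℝ) + 1) • ((i : ℝ) + 1) • A i j := by
        rw [← l, ← r]
        exact smul_comm _ _ _
      rw [smul_smul, smul_smul, ← sub_eq_zero, ← sub_smul, smul_eq_zero] at e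
      refine e.resolve_left fun e => hij ?_
      have : (i : ℝ) = j := by
        have hi0 : (0 : ℝ) ≤ (i : ℕ) := Nat.cast_nonneg _
        have hj0 : (0 : ℝ) ≤ (j : ℕ) := Nat.cast_nonneg _
        nlinarith
      exact_mod_cast this
    · rw [weight_mul_apply_of_le A j _ (not_lt.1 hj), star_zero] at r
      exact (smul_eq_zero.1 r.symm).resolve_left (hpos i)
  · have hj : (j : ℕ) < m := by omega
    have l := h₁.apply i ⟨j, hj⟩
    rw [mul_weight_apply A i j ⟨j, hj⟩ rfl,
      mul_weight_apply_of_le A ⟨j, hj⟩ i (not_lt.1 hi), star_zero] at l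
    exact (smul_eq_zero.1 l.symm).resolve_left (hpos j)

end QuaternionMatrix

open QuaternionMatrix in
/-- singular value decomposition of a quaternion matrix (QSVD): every
quaternion matrix `Q ∈ ℍ^{m×n}` factors as `Q = U S Vᴴ` with `U`, `V` unitary and `S`
"diagonal" with nonnegative real diagonal entries. -/
theorem quaternion_svd {m n : ℕ} (Q : Matrix (Fin m) (Fin n) (Quaternion ℝ)) :
    ∃ (U : Matrix (Fin m) (Fin m) (Quaternion ℝ))
      (S : Matrix (Fin m) (Fin n) (Quaternion ℝ))
      (V : Matrix (Fin n) (Fin n) (Quaternion ℝ)),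
      Uᴴ * U = 1 ∧ Vᴴ * V = 1 ∧
      (∀ (i : Fin m) (j : Fin n), (i : ℕ) ≠ (j : ℕ) → S i j = 0) ∧
      (∀ (i : Fin m) (j : Fin n), (i : ℕ) = (j : ℕ) → (S i j).im = 0 ∧ 0 ≤ (S i j).re) ∧
      Q = U * S * Vᴴ := by
  have hcont : Continuous fun p : Matrix (Fin m) (Fin m) (Quaternion ℝ) ×
      Matrix (Fin n) (Fin n) (Quaternion ℝ) => (weight n m * (p.1ᴴ * Q * p.2)).trace.re :=
    Quaternion.continuous_re.comp (by fun_prop)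
  obtain ⟨⟨U, V⟩, ⟨hU, hV⟩, hmax⟩ :=
    ((isCompact_unitary (ι := Fin m)).prod (isCompact_unitary (ι := Fin n))).exists_isMaxOn
      ⟨(1, 1), one_mem _, one_mem _⟩ hcont.continuousOn
  replace hU : U ∈ unitary (Matrix (Fin m) (Fin m) (Quaternion ℝ)) := hU
  replace hV : V ∈ unitary (Matrix (Fin n) (Fin n) (Quaternion ℝ)) := hV
  set A := Uᴴ * Q * V with hA
  have hr := isHermitian_and_diag_nonneg (M := weight n m * A) fun H hH => by
    have h : (weight n m * (Uᴴ * Q * (V * H))).trace.re ≤ (weight n m * A).trace.re :=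
      hmax (a := (U, V * H)) ⟨hU, mul_mem hV hH⟩
    simpa only [hA, Matrix.mul_assoc] using h
  have hl := isHermitian_and_diag_nonneg (M := A * weight n m) fun H hH => by
    have h : (weight n m * ((U * Hᴴ)ᴴ * Q * V)).trace.re ≤ (weight n m * A).trace.re :=
      hmax (a := (U * Hᴴ, V)) ⟨mul_mem hU (Unitary.star_mem hH), hV⟩
    rw [re_trace_mul_comm A, Matrix.mul_assoc, re_trace_mul_comm, Matrix.mul_assoc]
    simpa only [hA, conjTranspose_mul, conjTranspose_conjTranspose, Matrix.mul_assoc] using h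
  refine ⟨U, A, V, (Unitary.mem_iff.1 hU).1, (Unitary.mem_iff.1 hV).1,
    eq_zero_of_isHermitian_weight hl.1 hr.1, fun i j hij => ?_, ?_⟩
  · have hi : (i : ℕ) < n := hij ▸ j.2
    have hpos : (0 : ℝ) < (i : ℝ) + 1 := by positivity
    have e : (weight n m * A) j j = ((i : ℝ) + 1) • A i j := weight_mul_apply A j i j hij.symm
    have h1 := hr.1.apply j j
    have h2 := hr.2 j
    rw [e] at h1 h2
    constructor
    · rw [star_smul, star_trivial] at h1
      have h3 : star (A i j) = A i j := smul_right_injective _ hpos.ne' h1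
      rw [Quaternion.star_eq_self] at h3
      rw [h3, Quaternion.im_coe]
    · rw [Quaternion.re_smul, smul_eq_mul] at h2
      exact nonneg_of_mul_nonneg_right h2 hpos
  · have hU' : U * Uᴴ = 1 := (Unitary.mem_iff.1 hU).2
    have hV' : V * Vᴴ = 1 := (Unitary.mem_iff.1 hV).2
    calc Q = (U * Uᴴ) * Q * (V * Vᴴ) := by rw [hU', hV', Matrix.one_mul, Matrix.mul_one]
      _ = U * A * Vᴴ := by simp only [hA, Matrix.mul_assoc]
end

section
/- Least-squares optimality of the Q-DMD operator (quaternion case): let X ∈ ℍ^{n×m} and Y ∈ ℍ^{n×m} be quaternion matrices and suppose X Xᴴ is invertible, i.e., there exists W ∈ ℍ^{n×n} with (X Xᴴ) W = W (X Xᴴ) = I. Set Q₀ = Y Xᴴ W. Then for every quaternion matrix A ∈ ℍ^{n×n}, ‖Y − Q₀ X‖_F ≤ ‖Y − A X‖_F, where ‖M‖_F = sqrt(Σ_{i,j} |M_{ij}|²) is the quaternionic Frobenius norm. -/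
open Matrix

/-- The Frobenius norm of a quaternion matrix. -/
noncomputable def qFrobNorm {n m : ℕ} (M : Matrix (Fin n) (Fin m) (Quaternion ℝ)) : ℝ :=
  Real.sqrt (∑ i, ∑ j, ‖M i j‖ ^ 2)

/-- Adding a matrix with orthogonal rows does not decrease the Frobenius norm. -/
theorem qFrobNorm_le_qFrobNorm_add {n m : ℕ} {E F : Matrix (Fin n) (Fin m) (Quaternion ℝ)}
    (h : E * Fᴴ = 0) : qFrobNorm E ≤ qFrobNorm (E + F) := by
  refine Real.sqrt_le_sqrt (Finset.sum_le_sum fun i _ => ?_)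
  have h_inner : ∑ j, inner ℝ (E i j) (F i j) = 0 := by
    have h_diag : ∑ j, E i j * star (F i j) = 0 := by
      simpa [Matrix.mul_apply] using congrFun (congrFun h i) i
    calc ∑ j, inner ℝ (E i j) (F i j)
        = ∑ j, inner ℝ (E i j * star (F i j)) 1 := by simp [Quaternion.inner_def]
      _ = 0 := by rw [← sum_inner, h_diag, inner_zero_left]
  simp only [Matrix.add_apply, norm_add_sq_real, Finset.sum_add_distrib, ← Finset.mul_sum, h_inner]
  have h_nonneg : 0 ≤ ∑ j, ‖F i j‖ ^ 2 := by positivity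
  linarith

/-- least-squares optimality of the Q-DMD operator (quaternion case):
if `X Xᴴ` is invertible with inverse `W` and `Q₀ = Y Xᴴ W`, then
`‖Y − Q₀ X‖_F ≤ ‖Y − A X‖_F` for every quaternion matrix `A`. -/
theorem qdmd_least_squares {n m : ℕ} (X Y : Matrix (Fin n) (Fin m) (Quaternion ℝ))
    (W : Matrix (Fin n) (Fin n) (Quaternion ℝ))
    (hW1 : X * Xᴴ * W = 1) (hW2 : W * (X * Xᴴ) = 1)
    (A : Matrix (Fin n) (Fin n) (Quaternion ℝ)) :
    qFrobNorm (Y - Y * Xᴴ * W * X) ≤ qFrobNorm (Y - A * X) := by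
  have h_residual : (Y - Y * Xᴴ * W * X) * Xᴴ = 0 := by
    rw [Matrix.sub_mul, Matrix.mul_assoc _ X, Matrix.mul_assoc _ W, hW2, Matrix.mul_one, sub_self]
  have h_split : Y - A * X = (Y - Y * Xᴴ * W * X) + (Y * Xᴴ * W - A) * X := by
    rw [Matrix.sub_mul]
    abel
  rw [h_split]
  apply qFrobNorm_le_qFrobNorm_add
  rw [Matrix.conjTranspose_mul, ← Matrix.mul_assoc, h_residual, Matrix.zero_mul]
end

section
/- Exact DMD mode lifting (real case): let X, Y ∈ ℝ^{n×(m)} and suppose X = U Σ Vᵀ with U ∈ ℝ^{n×r}, Σ ∈ ℝ^{r×r}, V ∈ ℝ^{m×r} satisfying Uᵀ U = I_r, Vᵀ V = I_r, and Σ invertible. Define A = Y V Σ⁻¹ Uᵀ ∈ ℝ^{n×n} and Ã = Uᵀ Y V Σ⁻¹ ∈ ℝ^{r×r}. If w ∈ ℝ^r is a nonzero vector with Ã w = λ w for some λ ∈ ℝ with λ ≠ 0, then the DMD mode φ = Y V Σ⁻¹ w is nonzero and satisfies A φ = λ φ; that is, λ is an eigenvalue of A with eigenvector φ. -/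
open Matrix

/-- exact DMD mode lifting (real case): with `X = U Σ Vᵀ`, `Uᵀ U = I`,
`Vᵀ V = I`, `Σ` invertible, `A = Y V Σ⁻¹ Uᵀ` and `Ã = Uᵀ Y V Σ⁻¹`, every eigenpair
`(λ, w)` of `Ã` with `λ ≠ 0`, `w ≠ 0` lifts to the eigenpair `(λ, φ)` of `A` with DMD mode
`φ = Y V Σ⁻¹ w ≠ 0`. -/
theorem dmd_mode_lifting {n m r : ℕ} (X Y : Matrix (Fin n) (Fin m) ℝ)
    (U : Matrix (Fin n) (Fin r) ℝ) (S Sinv : Matrix (Fin r) (Fin r) ℝ)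
    (V : Matrix (Fin m) (Fin r) ℝ)
    (hX : X = U * S * Vᵀ) (hU : Uᵀ * U = 1) (hV : Vᵀ * V = 1)
    (hS1 : S * Sinv = 1) (hS2 : Sinv * S = 1)
    (w : Fin r → ℝ) (hw : w ≠ 0) (lam : ℝ) (hlam : lam ≠ 0)
    (heig : (Uᵀ * Y * V * Sinv).mulVec w = lam • w) :
    (Y * V * Sinv).mulVec w ≠ 0 ∧
      (Y * V * Sinv * Uᵀ).mulVec ((Y * V * Sinv).mulVec w) =
        lam • (Y * V * Sinv).mulVec w := by
  have hlift : Uᵀ *ᵥ ((Y * V * Sinv) *ᵥ w) = lam • w := by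
    rw [← heig, mulVec_mulVec]
    simp only [Matrix.mul_assoc]
  refine ⟨fun h => ?_, ?_⟩
  · rw [h, mulVec_zero] at hlift
    exact smul_ne_zero hlam hw hlift.symm
  · rw [← mulVec_mulVec, hlift, mulVec_smul]
end

section
/- Q-DMD mode lifting (quaternion case): let X, Y ∈ ℍ^{n×m} and suppose X = U Σ Vᴴ with U ∈ ℍ^{n×r}, V ∈ ℍ^{m×r} satisfying Uᴴ U = I_r and Vᴴ V = I_r, and with Σ ∈ ℍ^{r×r} an invertible matrix whose entries are real scalars (quaternions with zero imaginary part). Define Q = Y V Σ⁻¹ Uᴴ ∈ ℍ^{n×n} and Q̃ = Uᴴ Y V Σ⁻¹ ∈ ℍ^{r×r}. If w ∈ ℍ^r is a nonzero vector and λ ∈ ℍ, λ ≠ 0, is a right eigenvalue of Q̃ with eigenvector w (i.e., (Q̃ w)ᵢ = wᵢ λ for all i), then the Q-DMD mode φ = Y V Σ⁻¹ w ∈ ℍⁿ is nonzero and λ is a right eigenvalue of Q with eigenvector φ: (Q φ)ᵢ = φᵢ λ for all i. -/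
open Matrix

/-- Q-DMD mode lifting (quaternion case): with `X = U Σ Vᴴ`, `Uᴴ U = I`,
`Vᴴ V = I`, `Σ` invertible with real-scalar entries, `Q = Y V Σ⁻¹ Uᴴ` and
`Q̃ = Uᴴ Y V Σ⁻¹`, every right eigenpair `(λ, w)` of `Q̃` with `λ ≠ 0`, `w ≠ 0` lifts to
the right eigenpair `(λ, φ)` of `Q` with Q-DMD mode `φ = Y V Σ⁻¹ w ≠ 0`. -/
theorem qdmd_mode_lifting {n m r : ℕ} (X Y : Matrix (Fin n) (Fin m) (Quaternion ℝ))
    (U : Matrix (Fin n) (Fin r) (Quaternion ℝ))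
    (S Sinv : Matrix (Fin r) (Fin r) (Quaternion ℝ))
    (V : Matrix (Fin m) (Fin r) (Quaternion ℝ))
    (hX : X = U * S * Vᴴ) (hU : Uᴴ * U = 1) (hV : Vᴴ * V = 1)
    (hSreal : ∀ i j, (S i j).im = 0)
    (hS1 : S * Sinv = 1) (hS2 : Sinv * S = 1)
    (w : Fin r → Quaternion ℝ) (hw : w ≠ 0) (lam : Quaternion ℝ) (hlam : lam ≠ 0)
    (heig : ∀ i, (Uᴴ * Y * V * Sinv).mulVec w i = w i * lam) :
    (Y * V * Sinv).mulVec w ≠ 0 ∧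
      ∀ i, (Y * V * Sinv * Uᴴ).mulVec ((Y * V * Sinv).mulVec w) i =
        (Y * V * Sinv).mulVec w i * lam := by
  have hproj : Uᴴ *ᵥ ((Y * V * Sinv) *ᵥ w) = fun i => w i * lam := by
    funext i
    rw [← heig i, Matrix.mulVec_mulVec, Matrix.mul_assoc Uᴴ Y V, Matrix.mul_assoc Uᴴ]
  refine ⟨fun h0 => hw ?_, fun i => ?_⟩
  · rw [h0, Matrix.mulVec_zero] at hproj
    funext i
    exact (mul_eq_zero.mp (congrFun hproj i).symm).resolve_right hlam
  · rw [← Matrix.mulVec_mulVec, hproj]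
    simp only [Matrix.mulVec, dotProduct, Finset.sum_mul, mul_assoc]
end
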